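/- arXiv:2109.04985 — 4 statements merged into one kernel-verified Lean document; each statement's English description precedes it below -/
import Mathlib

section
/- (Temporal dynamics are slower than aggregate dynamics.) Let c < 0 and let μ be a real number with c < μ < 0. Then for every τ > 0, the effective temporal eigenvalue f_c(μ,τ) = τ⁻¹·ln(1 + α(c,τ)·μ), with α(c,τ) = (exp(cτ) − 1)/c, satisfies μ < f_c(μ,τ) < 0; that is, the effective temporal eigenvalue is strictly smaller in absolute value than the aggregated eigenvalue μ while keeping its negative sign. Moreover, if μ = c then f_c(μ,τ) = μ for all τ > 0. -/
/-- The secant line of `exp` over `[x, 0]` lies strictly above its graph. -/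
lemma exp_mul_lt_one_add_mul {x r : ℝ} (hx : x ≠ 0) (hr0 : 0 < r) (hr1 : r < 1) :
    Real.exp (r * x) < 1 + r * (Real.exp x - 1) := by
  have h := strictConvexOn_exp.2 (Set.mem_univ x) (Set.mem_univ 0) hx hr0
    (sub_pos.2 hr1) (add_sub_cancel r 1)
  simp only [smul_eq_mul, mul_zero, add_zero, Real.exp_zero, mul_one] at h
  linarith

theorem temporal_slower_than_aggregate (c μ : ℝ)
    (hc : c < 0) (hcμ : c < μ) (hμ : μ < 0) :
    (∀ τ : ℝ, 0 < τ →
        μ < τ⁻¹ * Real.log (1 + ((Real.exp (c * τ) - 1) / c) * μ) ∧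
        τ⁻¹ * Real.log (1 + ((Real.exp (c * τ) - 1) / c) * μ) < 0) ∧
    (∀ τ : ℝ, 0 < τ →
        τ⁻¹ * Real.log (1 + ((Real.exp (c * τ) - 1) / c) * c) = c) := by
  refine ⟨fun τ hτ => ?_, fun τ hτ => ?_⟩
  · have hcτ : c * τ < 0 := mul_neg_of_neg_of_pos hc hτ
    have hr0 : 0 < μ / c := div_pos_of_neg_of_neg hμ hc
    have hr1 : μ / c < 1 := (div_lt_one_of_neg hc).2 hcμ
    have hlt := exp_mul_lt_one_add_mul hcτ.ne hr0 hr1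
    have hexp : Real.exp (c * τ) - 1 < 0 := sub_neg.2 (Real.exp_lt_one_iff.2 hcτ)
    have harg : (Real.exp (c * τ) - 1) / c * μ = μ / c * (Real.exp (c * τ) - 1) := by ring
    rw [← mul_assoc, div_mul_cancel₀ μ hc.ne] at hlt
    rw [harg]
    have hpos := (Real.exp_pos (μ * τ)).trans hlt
    constructor
    · rw [lt_inv_mul_iff₀ hτ, mul_comm τ μ]
      exact (Real.lt_log_iff_exp_lt hpos).2 hlt
    · refine mul_neg_of_pos_of_neg (inv_pos.2 hτ) (Real.log_neg hpos ?_)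
      linarith [mul_neg_of_pos_of_neg hr0 hexp]
  · rw [div_mul_cancel₀ _ hc.ne, add_sub_cancel, Real.log_exp]
    field_simp
end

section
/- Let c < 0 and let μ be a real number with c ≤ μ < 0, and let α(c,τ) = (exp(cτ) − 1)/c. Then the function h(τ) = ln(1 + α(c,τ)·μ) is convex on [0,∞). -/
/-- The logarithm of a convex combination of `1` and `exp (c * t)` is convex in `t`. -/
theorem convexOn_log_one_sub_add_mul_exp {c p : ℝ} (hc : c ≤ 0) (hp₀ : 0 < p) (hp₁ : p ≤ 1) :
    ConvexOn ℝ Set.univ (fun t : ℝ => Real.log (1 - p + p * Real.exp (c * t))) := by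
  have hpos (t : ℝ) : 0 < 1 - p + p * Real.exp (c * t) :=
    add_pos_of_nonneg_of_pos (sub_nonneg.2 hp₁) (mul_pos hp₀ (Real.exp_pos _))
  have hderiv (t : ℝ) : HasDerivAt (fun t : ℝ => Real.log (1 - p + p * Real.exp (c * t)))
      (p * (Real.exp (c * t) * c) / (1 - p + p * Real.exp (c * t))) t := by
    have hlin : HasDerivAt (fun t : ℝ => c * t) c t := by
      simpa using (hasDerivAt_id t).const_mul c
    exact ((hlin.exp.const_mul p).const_add (1 - p)).log (hpos t).ne'
  refine Monotone.convexOn_univ_of_deriv (fun t => (hderiv t).differentiableAt) fun x y hxy => ?_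
  rw [(hderiv x).deriv, (hderiv y).deriv, div_le_div_iff₀ (hpos x) (hpos y)]
  have hexp : Real.exp (c * y) ≤ Real.exp (c * x) :=
    Real.exp_le_exp.2 (mul_le_mul_of_nonpos_left hxy hc)
  have hgap : 0 ≤ p * (-c) * ((1 - p) * (Real.exp (c * x) - Real.exp (c * y))) :=
    mul_nonneg (mul_nonneg hp₀.le (neg_nonneg.2 hc))
      (mul_nonneg (sub_nonneg.2 hp₁) (sub_nonneg.2 hexp))
  linarith

theorem log_one_add_alpha_mu_convex (c μ : ℝ) (hc : c < 0) (hcμ : c ≤ μ) (hμ : μ < 0) :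
    ConvexOn ℝ (Set.Ici (0 : ℝ))
      (fun τ : ℝ => Real.log (1 + ((Real.exp (c * τ) - 1) / c) * μ)) := by
  have hconv := (convexOn_log_one_sub_add_mul_exp hc.le (div_pos_of_neg_of_neg hμ hc)
    ((div_le_one_of_neg hc).2 hcμ)).subset (Set.subset_univ _) (convex_Ici (0 : ℝ))
  convert hconv using 3 with τ
  ring
end

section
/- (Monotone slow-down of the temporal convergence rate.) Let c < 0 and let μ be a real number with c ≤ μ < 0, and let α(c,τ) = (exp(cτ) − 1)/c. Then the convergence rate g(τ) = −τ⁻¹·ln(1 + α(c,τ)·μ) of the effective temporal dynamics is monotonically decreasing on (0,∞): for all 0 < τ₁ ≤ τ₂, g(τ₂) ≤ g(τ₁). -/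
/-- Power mean inequality in logarithmic form, for the two points `1` and `exp (c * t)`. -/
theorem log_one_add_mul_exp_sub_one_le {p : ℝ} (hp₀ : 0 < p) (hp₁ : p ≤ 1) (c : ℝ) {s t : ℝ}
    (hs : 0 < s) (hst : s ≤ t) :
    Real.log (1 + p * (Real.exp (c * s) - 1)) ≤
      s / t * Real.log (1 + p * (Real.exp (c * t) - 1)) := by
  have ht : 0 < t := hs.trans_le hst
  have hpos (u : ℝ) : 0 < 1 + p * (Real.exp (c * u) - 1) := by
    nlinarith [mul_pos hp₀ (Real.exp_pos (c * u))]
  have hconc := (Real.concaveOn_rpow (div_pos hs ht).le ((div_le_one ht).2 hst)).2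
    (Set.mem_Ici.2 zero_le_one) (Set.mem_Ici.2 (Real.exp_pos (c * t)).le)
    (sub_nonneg.2 hp₁) hp₀.le (sub_add_cancel 1 p)
  have hexp : Real.exp (c * t) ^ (s / t) = Real.exp (c * s) := by
    rw [← Real.exp_mul]
    congr 1
    field_simp
  have hmean : 1 - p + p * Real.exp (c * t) = 1 + p * (Real.exp (c * t) - 1) := by ring
  simp only [smul_eq_mul, Real.one_rpow, mul_one, hexp, hmean] at hconc
  rw [← Real.log_rpow (hpos t)]
  exact Real.log_le_log (hpos s) (by linarith)

theorem temporal_convergence_rate_monotone_decreasing (c μ : ℝ)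
    (hc : c < 0) (hcμ : c ≤ μ) (hμ : μ < 0) :
    ∀ τ₁ τ₂ : ℝ, 0 < τ₁ → τ₁ ≤ τ₂ →
      -(τ₂⁻¹ * Real.log (1 + ((Real.exp (c * τ₂) - 1) / c) * μ)) ≤
      -(τ₁⁻¹ * Real.log (1 + ((Real.exp (c * τ₁) - 1) / c) * μ)) := by
  intro τ₁ τ₂ h₁ h₁₂
  have hlog := log_one_add_mul_exp_sub_one_le (div_pos_of_neg_of_neg hμ hc)
    ((div_le_one_of_neg hc).2 hcμ) c h₁ h₁₂
  have hα (τ : ℝ) : (Real.exp (c * τ) - 1) / c * μ = μ / c * (Real.exp (c * τ) - 1) := by ring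
  rw [hα, hα, neg_le_neg_iff, inv_mul_le_iff₀ h₁]
  calc _ ≤ _ := hlog
    _ = _ := by ring
end

section
/- (Three-way temporal dynamics are slower than pairwise temporal dynamics.) Let d be a real number with d > 3, let τ > 0, and let μ be a real number with −d ≤ μ < 0. Then τ⁻¹·ln(1 + α(−d,τ)·μ) < τ⁻¹·ln(1 + α(−d(d−2),τ)·μ), where α(c,τ) = (exp(cτ) − 1)/c; that is, given the same aggregated eigenvalue μ, the effective temporal eigenvalue for three-way interactions on d-groups is strictly larger (closer to zero, hence slower) than that for pairwise interactions on d-groups. -/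
/-- For `τ > 0`, the map `c ↦ (exp (c τ) - 1) / c` is strictly increasing away from `0`. -/
lemma exp_mul_sub_one_div_lt {τ a b : ℝ} (hτ : 0 < τ) (ha : a ≠ 0) (hb : b ≠ 0) (hab : a < b) :
    (Real.exp (a * τ) - 1) / a < (Real.exp (b * τ) - 1) / b := by
  have h := strictConvexOn_exp.secant_strict_mono (Set.mem_univ 0) (Set.mem_univ (a * τ))
    (Set.mem_univ (b * τ)) (mul_ne_zero ha hτ.ne') (mul_ne_zero hb hτ.ne')
    (mul_lt_mul_of_pos_right hab hτ)
  simp only [Real.exp_zero, sub_zero, ← div_div] at h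
  exact (div_lt_div_iff_of_pos_right hτ).mp h

theorem threeway_temporal_slower_than_pairwise (d τ μ : ℝ)
    (hd : 3 < d) (hτ : 0 < τ) (hμl : -d ≤ μ) (hμ : μ < 0) :
    τ⁻¹ * Real.log (1 + ((Real.exp (-d * τ) - 1) / (-d)) * μ) <
    τ⁻¹ * Real.log (1 + ((Real.exp (-(d * (d - 2)) * τ) - 1) / (-(d * (d - 2)))) * μ) := by
  have hlt : d < d * (d - 2) := by nlinarith
  have hα := exp_mul_sub_one_div_lt hτ (a := -(d * (d - 2))) (b := -d)
    (by linarith) (by linarith) (by linarith)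
  have hexp : Real.exp (-d * τ) < 1 := Real.exp_lt_one_iff.mpr (by nlinarith)
  have hpos : 0 < (Real.exp (-d * τ) - 1) / (-d) :=
    div_pos_of_neg_of_neg (by linarith) (by linarith)
  have hmul : (Real.exp (-d * τ) - 1) / (-d) * (-d) = Real.exp (-d * τ) - 1 :=
    div_mul_cancel₀ _ (by linarith)
  have harg : 0 < 1 + (Real.exp (-d * τ) - 1) / (-d) * μ := by
    linarith [mul_le_mul_of_nonneg_left hμl hpos.le, Real.exp_pos (-d * τ)]
  exact mul_lt_mul_of_pos_left
    (Real.log_lt_log harg (by linarith [mul_lt_mul_of_neg_right hα hμ])) (inv_pos.mpr hτ)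
end
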